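/- Let V be a finite set with a metric cost function c, let R ⊆ V with |R| ≥ 2, and let T be any tree in the complete graph on V whose vertex set contains R. Then mst(R), the minimum cost of a tree with vertex set exactly R, is at most 2·c(T). -/

import Mathlib

open scoped Classical

/-- The cost of a simple graph: the sum of the costs of its edges (for a
symmetric cost function, each unordered edge is counted once). -/
noncomputable def graphCost {α : Type*} [Fintype α] (c : α → α → ℝ) (G : SimpleGraph α) : ℝ :=
  (∑ x : α, ∑ y : α, if G.Adj x y then c x y else 0) / 2

/-- `mstCost c R` is the minimum cost of a tree whose vertex set is exactly
`R`. -/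
noncomputable def mstCost {V : Type*} [Fintype V] (c : V → V → ℝ) (R : Finset V) : ℝ :=
  sInf {x : ℝ | ∃ T : SimpleGraph {v : V // v ∈ R},
    T.IsTree ∧ graphCost (fun a b => c a.1 b.1) T = x}

/-- The total cost of the steps between consecutive entries of a list. -/
def listCost {α : Type*} (c : α → α → ℝ) : List α → ℝ
  | [] => 0
  | [_] => 0
  | a :: b :: l => c a b + listCost c (b :: l)

lemma listCost_map {α β : Type*} (c : β → β → ℝ) (f : α → β) (l : List α) :
    listCost c (l.map f) = listCost (fun a b => c (f a) (f b)) l := by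
  induction l with
  | nil => rfl
  | cons a l ih => cases l <;> simp_all [listCost]

lemma listCost_le_cons {α : Type*} (c : α → α → ℝ) (hnn : ∀ u v, 0 ≤ c u v) (a : α)
    (l : List α) : listCost c l ≤ listCost c (a :: l) := by
  cases l with
  | nil => simp [listCost]
  | cons b l => simpa [listCost] using hnn a b

lemma listCost_cons_le_cons_cons {α : Type*} (c : α → α → ℝ) (hnn : ∀ u v, 0 ≤ c u v)
    (htri : ∀ u v w, c u w ≤ c u v + c v w) (a b : α) (l : List α) :
    listCost c (a :: l) ≤ c a b + listCost c (b :: l) := by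
  cases l with
  | nil => simpa [listCost] using hnn a b
  | cons d l =>
    simp only [listCost]
    linarith [htri a b d]

lemma listCost_le_of_sublist {α : Type*} (c : α → α → ℝ) (hnn : ∀ u v, 0 ≤ c u v)
    (htri : ∀ u v w, c u w ≤ c u v + c v w) {l₁ l₂ : List α} (h : l₁.Sublist l₂) :
    listCost c l₁ ≤ listCost c l₂ ∧ ∀ a, listCost c (a :: l₁) ≤ listCost c (a :: l₂) := by
  induction h with
  | slnil => simp
  | @cons l₁ l₂ b _ ih =>
    refine ⟨ih.1.trans (listCost_le_cons c hnn b l₂), fun a => ?_⟩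
    have h₁ := listCost_cons_le_cons_cons c hnn htri a b l₁
    have h₂ := ih.2 b
    simp only [listCost]
    linarith
  | @cons_cons l₁ l₂ b _ ih =>
    refine ⟨ih.2 b, fun a => ?_⟩
    simpa only [listCost, add_le_add_iff_left] using ih.2 b

lemma graphCost_mono {α : Type*} [Fintype α] (c : α → α → ℝ) (hnn : ∀ u v, 0 ≤ c u v)
    {G H : SimpleGraph α} (h : G ≤ H) : graphCost c G ≤ graphCost c H := by
  unfold graphCost
  gcongr with x _ y _
  by_cases hG : G.Adj x y
  · simp [hG, h hG]
  · rw [if_neg hG]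
    split_ifs
    exacts [hnn x y, le_rfl]

lemma graphCost_nonneg {α : Type*} [Fintype α] (c : α → α → ℝ) (hnn : ∀ u v, 0 ≤ c u v)
    (G : SimpleGraph α) : 0 ≤ graphCost c G := by
  unfold graphCost
  refine div_nonneg (Finset.sum_nonneg fun x _ => Finset.sum_nonneg fun y _ => ?_) zero_le_two
  split_ifs
  exacts [hnn x y, le_rfl]

lemma graphCost_sup_le {α : Type*} [Fintype α] (c : α → α → ℝ) (hnn : ∀ u v, 0 ≤ c u v)
    (G H : SimpleGraph α) : graphCost c (G ⊔ H) ≤ graphCost c G + graphCost c H := by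
  unfold graphCost
  rw [← add_div, ← Finset.sum_add_distrib]
  simp_rw [← Finset.sum_add_distrib]
  gcongr with x _ y _
  have := hnn x y
  simp only [SimpleGraph.sup_adj]
  split_ifs <;> first | linarith | tauto

lemma graphCost_edge_le {α : Type*} [Fintype α] (c : α → α → ℝ) (hnn : ∀ u v, 0 ≤ c u v)
    (hsymm : ∀ u v, c u v = c v u) (a b : α) :
    graphCost c (SimpleGraph.edge a b) ≤ c a b := by
  have key : (∑ x, ∑ y, if (SimpleGraph.edge a b).Adj x y then c x y else 0) ≤
      ∑ x, ∑ y, ((if x = a then if y = b then c a b else 0 else 0) +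
        (if x = b then if y = a then c a b else 0 else 0)) := by
    gcongr with x _ y _
    have := hnn a b
    have := hsymm a b
    simp only [SimpleGraph.edge_adj]
    split_ifs <;> grind
  have hsum : ∑ x, ∑ y, ((if x = a then if y = b then c a b else 0 else 0) +
      (if x = b then if y = a then c a b else 0 else 0)) = 2 * c a b := by
    simp [Finset.sum_add_distrib, Finset.sum_ite_irrel, two_mul]
  rw [graphCost, div_le_iff₀ two_pos, mul_comm, ← hsum]
  refine Eq.trans_le ?_ key
  congr!

/-- A list through every vertex carries a spanning tree that costs no more than the list. -/
lemma exists_isTree_graphCost_le_listCost {α : Type*} [Fintype α] (c : α → α → ℝ)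
    (hnn : ∀ u v, 0 ≤ c u v) (hsymm : ∀ u v, c u v = c v u) [Nonempty α] (l : List α)
    (hl : ∀ x, x ∈ l) : ∃ T : SimpleGraph α, T.IsTree ∧ graphCost c T ≤ listCost c l := by
  have key : ∀ l : List α, ∃ G : SimpleGraph α, (∀ x ∈ l, ∀ y ∈ l, G.Reachable x y) ∧
      graphCost c G ≤ listCost c l := by
    intro l
    induction l with
    | nil => exact ⟨⊥, by simp, by simp [graphCost, listCost]⟩
    | cons a l ih =>
      cases l with
      | nil => exact ⟨⊥, by simp, by simp [graphCost, listCost]⟩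
      | cons b l =>
        obtain ⟨G, hG, hc⟩ := ih
        have hab : (SimpleGraph.edge a b ⊔ G).Reachable a b := by
          by_cases h : a = b
          · subst h; rfl
          · exact SimpleGraph.Adj.reachable (Or.inl (by simp [SimpleGraph.edge_adj, h]))
        have hb : ∀ x ∈ a :: b :: l, (SimpleGraph.edge a b ⊔ G).Reachable x b := by
          intro x hx
          rcases List.mem_cons.1 hx with rfl | hx
          · exact hab
          · exact (hG x hx b (by simp)).mono le_sup_right
        refine ⟨_, fun x hx y hy => (hb x hx).trans (hb y hy).symm, ?_⟩
        have h₁ := graphCost_sup_le c hnn (SimpleGraph.edge a b) G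
        have h₂ := graphCost_edge_le c hnn hsymm a b
        simp only [listCost]
        linarith
  obtain ⟨G, hG, hc⟩ := key l
  have hconn : G.Connected := ⟨fun x y => hG x (hl x) y (hl y)⟩
  obtain ⟨T, hTG, hT⟩ := hconn.exists_isTree_le
  exact ⟨T, hT, (graphCost_mono c hnn hTG).trans hc⟩

/-- A connected finite graph has a closed walk through all vertices that uses every dart at most
once. -/
lemma SimpleGraph.Connected.exists_closed_walk_darts_nodup {α : Type*} [Fintype α]
    {G : SimpleGraph α} (hG : G.Connected) (r : α) :
    ∃ w : G.Walk r r, w.darts.Nodup ∧ ∀ x, x ∈ w.support := by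
  have key : ∀ n : ℕ, ∃ w : G.Walk r r, w.darts.Nodup ∧
      ((∀ x, x ∈ w.support) ∨ n ≤ w.darts.length) := by
    intro n
    induction n with
    | zero => exact ⟨.nil, by simp, by simp⟩
    | succ n ih =>
      obtain ⟨w, hw, h⟩ := ih
      by_cases hall : ∀ x, x ∈ w.support
      · exact ⟨w, hw, .inl hall⟩
      obtain ⟨x, hx⟩ := not_forall.1 hall
      have hn := h.resolve_left hall
      obtain ⟨p⟩ := hG.preconnected r x
      obtain ⟨d, -, hd₁, hd₂⟩ :=
        p.exists_boundary_dart {y | y ∈ w.support} w.start_mem_support hx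
      have hfst : ∀ e ∈ w.darts, e.fst ≠ d.snd := fun e he h =>
        hd₂ (h ▸ w.dart_fst_mem_support_of_mem_darts he)
      have hsnd : ∀ e ∈ w.darts, e.snd ≠ d.snd := fun e he h =>
        hd₂ (h ▸ w.dart_snd_mem_support_of_mem_darts he)
      let w' := (w.takeUntil d.fst hd₁).append
        (.cons d.adj (.cons d.adj.symm (w.dropUntil d.fst hd₁)))
      have hperm : w'.darts.Perm (d :: d.symm :: w.darts) := by
        conv_rhs => rw [← w.take_spec hd₁]
        simp only [w', SimpleGraph.Walk.darts_append, SimpleGraph.Walk.darts_cons]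
        exact List.perm_middle.trans (List.perm_middle.cons _)
      refine ⟨w', hperm.nodup_iff.2 ?_, .inr ?_⟩
      · have h₁ : d ∉ w.darts := fun h => hsnd d h rfl
        have h₂ : d.symm ∉ w.darts := fun h => hfst _ h rfl
        simp [hw, h₁, h₂, d.symm_ne.symm]
      · rw [hperm.length_eq]
        simp only [List.length_cons]
        omega
  obtain ⟨w, hw, h⟩ := key (Fintype.card G.Dart + 1)
  refine ⟨w, hw, h.resolve_right fun h => ?_⟩
  have := hw.length_le_card
  omega

lemma SimpleGraph.Walk.listCost_support {α : Type*} (c : α → α → ℝ) {G : SimpleGraph α}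
    {u v : α} (w : G.Walk u v) :
    listCost c w.support = (w.darts.map fun d => c d.fst d.snd).sum := by
  induction w with
  | nil => simp [listCost]
  | cons h p ih =>
    rw [SimpleGraph.Walk.support_cons, SimpleGraph.Walk.darts_cons, List.map_cons,
      List.sum_cons, ← ih]
    cases p <;> simp [listCost]

lemma SimpleGraph.Walk.listCost_support_le {α : Type*} [Fintype α] (c : α → α → ℝ)
    (hnn : ∀ u v, 0 ≤ c u v) {G : SimpleGraph α} {u v : α} (w : G.Walk u v)
    (hw : w.darts.Nodup) : listCost c w.support ≤ 2 * graphCost c G := by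
  have hinj : Function.Injective (SimpleGraph.Dart.toProd (G := G)) :=
    SimpleGraph.Dart.toProd_injective
  calc listCost c w.support
      = ∑ d ∈ w.darts.toFinset, c d.fst d.snd := by
        rw [w.listCost_support, List.sum_toFinset _ hw]
    _ = ∑ p ∈ w.darts.toFinset.map ⟨_, hinj⟩, if G.Adj p.1 p.2 then c p.1 p.2 else 0 := by
        rw [Finset.sum_map]
        exact Finset.sum_congr rfl fun d _ => (if_pos d.adj).symm
    _ ≤ ∑ p : α × α, if G.Adj p.1 p.2 then c p.1 p.2 else 0 := by
        refine Finset.sum_le_univ_sum_of_nonneg fun p => ?_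
        split_ifs
        exacts [hnn _ _, le_rfl]
    _ = 2 * graphCost c G := by
        rw [Fintype.sum_prod_type, graphCost]
        ring

/-- For any tree `T` (on a vertex set `S` in the complete graph on `V`) whose
vertex set contains `R`, with `|R| ≥ 2`, the minimum spanning tree cost of
`R` is at most `2 · c(T)`. -/
theorem mst_le_two_steiner {V : Type*} [Fintype V] [DecidableEq V]
    (c : V → V → ℝ)
    (hnn : ∀ u v, 0 ≤ c u v) (hsymm : ∀ u v, c u v = c v u)
    (hrefl : ∀ v, c v v = 0) (htri : ∀ u v w, c u w ≤ c u v + c v w)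
    (R : Finset V) (h2 : 2 ≤ R.card)
    (S : Finset V) (hRS : R ⊆ S)
    (T : SimpleGraph {x : V // x ∈ S}) (hT : T.IsTree) :
    mstCost c R ≤ 2 * graphCost (fun a b => c a.1 b.1) T := by
  obtain ⟨r, hr⟩ : R.Nonempty := Finset.card_pos.1 (by omega)
  obtain ⟨w, hw, hcover⟩ := hT.connected.exists_closed_walk_darts_nodup ⟨r, hRS hr⟩
  have hwc := w.listCost_support_le (fun a b => c a.1 b.1) (fun _ _ => hnn _ _) hw
  rw [← listCost_map] at hwc
  obtain ⟨l, hl⟩ : ∃ l : List {v // v ∈ R},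
      l.map Subtype.val = (w.support.map Subtype.val).filter (· ∈ R) :=
    CanLift.prf _ fun x hx => by simpa using (List.mem_filter.1 hx).2
  have hlc := (listCost_le_of_sublist c hnn htri
    (List.filter_sublist (p := (· ∈ R)) (l := w.support.map Subtype.val))).1
  rw [← hl, listCost_map] at hlc
  have hmem : ∀ x, x ∈ l := by
    intro x
    have hx : x.1 ∈ l.map Subtype.val := by
      rw [hl, List.mem_filter]
      exact ⟨List.mem_map.2 ⟨⟨x.1, hRS x.2⟩, hcover _, rfl⟩, by simp⟩
    simpa using hx
  have : Nonempty {v // v ∈ R} := ⟨⟨r, hr⟩⟩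
  obtain ⟨T', hT', hc⟩ := exists_isTree_graphCost_le_listCost (fun a b => c a.1 b.1)
    (fun _ _ => hnn _ _) (fun _ _ => hsymm _ _) l hmem
  refine le_trans (csInf_le ⟨0, ?_⟩ ⟨T', hT', rfl⟩) (hc.trans (hlc.trans hwc))
  rintro _ ⟨T', -, rfl⟩
  exact graphCost_nonneg _ (fun _ _ => hnn _ _) T'
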